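/- Let a ≤ b be real numbers and let ξ_L, ξ_U : ℝ → ℝ be continuous on [a,b] and antitone on [a,b], satisfying ξ_L(v) ≤ ξ_U(v) for every v ∈ [a,b] and mapping [a,b] into [a,b]. Define the WCS recursion p₀ = a, q₀ = b, p_{k+1} = ξ_L(q_k), q_{k+1} = ξ_U(p_k). Then the limits p* = lim_{k→∞} p_k and q* = lim_{k→∞} q_k exist, satisfy a ≤ p* ≤ q* ≤ b, and form a 2-cycle of the bound maps: ξ_U(p*) = q* and ξ_L(q*) = p*. -/

import Mathlib

open Filter Topology

/-- Convergence of the worst-case-scenario (WCS) cobwebbing recursion to a limiting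
2-cycle: for continuous antitone bound maps `ξ_L ≤ ξ_U` of `[a,b]` into itself and
the recursion `p₀ = a`, `q₀ = b`, `p_{k+1} = ξ_L (q_k)`, `q_{k+1} = ξ_U (p_k)`, the
limits `p*`, `q*` exist, satisfy `a ≤ p* ≤ q* ≤ b`, and form a 2-cycle:
`ξ_U p* = q*` and `ξ_L q* = p*`. -/
theorem stmt7 (a b : ℝ) (hab : a ≤ b) (ξL ξU : ℝ → ℝ)
    (hLc : ContinuousOn ξL (Set.Icc a b)) (hUc : ContinuousOn ξU (Set.Icc a b))
    (hLa : AntitoneOn ξL (Set.Icc a b)) (hUa : AntitoneOn ξU (Set.Icc a b))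
    (hLU : ∀ v ∈ Set.Icc a b, ξL v ≤ ξU v)
    (hLmap : ∀ v ∈ Set.Icc a b, ξL v ∈ Set.Icc a b)
    (hUmap : ∀ v ∈ Set.Icc a b, ξU v ∈ Set.Icc a b)
    (p q : ℕ → ℝ) (hp0 : p 0 = a) (hq0 : q 0 = b)
    (hp : ∀ k, p (k + 1) = ξL (q k)) (hq : ∀ k, q (k + 1) = ξU (p k)) :
    ∃ pstar qstar : ℝ,
      Tendsto p atTop (𝓝 pstar) ∧ Tendsto q atTop (𝓝 qstar) ∧
      a ≤ pstar ∧ pstar ≤ qstar ∧ qstar ≤ b ∧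
      ξU pstar = qstar ∧ ξL qstar = pstar := by
  have hmem : ∀ k, p k ∈ Set.Icc a b ∧ q k ∈ Set.Icc a b := by
    intro k
    induction k with
    | zero => rw [hp0, hq0]; exact ⟨⟨le_refl _, hab⟩, ⟨hab, le_refl _⟩⟩
    | succ k ih => rw [hp, hq]; exact ⟨hLmap _ ih.2, hUmap _ ih.1⟩
  have hpq : ∀ k, p k ≤ q k := by
    intro k
    induction k with
    | zero => rw [hp0, hq0]; exact hab
    | succ k ih =>
      rw [hp, hq]
      exact (hLa (hmem k).1 (hmem k).2 ih).trans (hLU _ (hmem k).1)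
  have hmono : ∀ k, p k ≤ p (k + 1) ∧ q (k + 1) ≤ q k := by
    intro k
    induction k with
    | zero => rw [hp0, hq0]; exact ⟨(hmem 1).1.1, (hmem 1).2.2⟩
    | succ k ih =>
      rw [hp (k + 1), hq (k + 1)]
      constructor
      · rw [hp k]; exact hLa (hmem (k + 1)).2 (hmem k).2 ih.2
      · rw [hq k]; exact hUa (hmem k).1 (hmem (k + 1)).1 ih.1
  have hpm : Monotone p := monotone_nat_of_le_succ fun k => (hmono k).1
  have hqm : Antitone q := antitone_nat_of_succ_le fun k => (hmono k).2
  have hP := tendsto_atTop_ciSup hpm ⟨b, by rintro _ ⟨k, rfl⟩; exact (hmem k).1.2⟩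
  have hQ := tendsto_atTop_ciInf hqm ⟨a, by rintro _ ⟨k, rfl⟩; exact (hmem k).2.1⟩
  have hPm := isClosed_Icc.mem_of_tendsto hP (Eventually.of_forall fun k => (hmem k).1)
  have hQm := isClosed_Icc.mem_of_tendsto hQ (Eventually.of_forall fun k => (hmem k).2)
  refine ⟨_, _, hP, hQ, hPm.1, le_of_tendsto_of_tendsto' hP hQ hpq, hQm.2, ?_, ?_⟩
  · have h1 := (hUc _ hPm).tendsto.comp
      (tendsto_nhdsWithin_iff.2 ⟨hP, Eventually.of_forall fun k => (hmem k).1⟩)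
    have h2 := hQ.comp (tendsto_add_atTop_nat 1)
    exact tendsto_nhds_unique h1 (h2.congr fun k => hq k)
  · have h1 := (hLc _ hQm).tendsto.comp
      (tendsto_nhdsWithin_iff.2 ⟨hQ, Eventually.of_forall fun k => (hmem k).2⟩)
    have h2 := hP.comp (tendsto_add_atTop_nat 1)
    exact tendsto_nhds_unique h1 (h2.congr fun k => hp k)
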